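/- Let D > 1 be a squarefree integer with D ≡ 2 or 3 (mod 4) and let K = ℚ(√D), so that O_K = ℤ[√D]. Then every indecomposable element α ∈ O_K^+ satisfies N_{K/ℚ}(α) ≤ D. -/

import Mathlib

open NumberField

theorem Irrational.int_add_int_mul_eq_zero {r : ℝ} (hr : Irrational r) {u v : ℤ}
    (h : (u : ℝ) + v * r = 0) : u = 0 ∧ v = 0 := by
  rcases eq_or_ne v 0 with rfl | hv
  · simpa using h
  · exact absurd h ((hr.intCast_mul hv).intCast_add u).ne_zero

/-- A totally positive element `x + y√D` of norm greater than `D` is the sum of two totally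
positive elements `u + v√D` and `(x - u) + (y - v)√D`. -/
theorem exists_totallyPositive_decomposition {D : ℤ} {r : ℝ} (hr : Irrational r) (hr0 : 0 < r)
    (hrD : r ^ 2 = D) {x y : ℤ} (hA : (0 : ℝ) < x + y * r) (hB : (0 : ℝ) < x - y * r)
    (hN : D < x ^ 2 - D * y ^ 2) :
    ∃ u v : ℤ, (0 : ℝ) < u + v * r ∧ (0 : ℝ) < u - v * r ∧
      (u + v * r : ℝ) < x + y * r ∧ (u - v * r : ℝ) < x - y * r := by
  by_cases hc : IsCoprime x y
  · obtain ⟨a, b, hab⟩ := hc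
    set A : ℝ := x + y * r with hAdef
    set B : ℝ := x - y * r with hBdef
    set k : ℤ := ⌊(-b + a * r) / A⌋ with hk
    obtain ⟨u, hu⟩ : ∃ u : ℤ, u = -b - k * x := ⟨_, rfl⟩
    obtain ⟨v, hv⟩ : ∃ v : ℤ, v = a - k * y := ⟨_, rfl⟩
    have hlevel : x * v - y * u = 1 := by rw [hu, hv]; linear_combination hab
    have hne : ¬ (u = 0 ∧ v = 0) := by
      rintro ⟨rfl, rfl⟩
      simp at hlevel
    have hlevel' : (x * v - y * u : ℝ) = 1 := by exact_mod_cast hlevel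
    have hs : (u + v * r : ℝ) = (-b + a * r) - k * A := by
      rw [hu, hv, hAdef]; push_cast; ring
    have hs0 : (0 : ℝ) ≤ u + v * r := by
      have := (le_div_iff₀ hA).1 (Int.floor_le ((-b + a * r) / A))
      rw [hs]; linarith
    have hsA : (u + v * r : ℝ) < A := by
      have := (div_lt_iff₀ hA).1 (Int.lt_floor_add_one ((-b + a * r) / A))
      rw [hs]; linarith
    have hspos : (0 : ℝ) < u + v * r :=
      hs0.lt_of_ne fun h ↦ hne (hr.int_add_int_mul_eq_zero h.symm)
    have hrel : A * (u - v * r) = B * (u + v * r) - 2 * r := by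
      rw [hAdef, hBdef]; linear_combination (-2 * r) * hlevel'
    have htB : (u - v * r : ℝ) < B := by
      refine lt_of_mul_lt_mul_left ?_ hA.le
      nlinarith
    refine ⟨u, v, hspos, ?_, hsA, htB⟩
    by_contra! ht
    have htneg : (u - v * r : ℝ) < 0 := by
      refine ht.lt_of_ne fun h ↦ hne ?_
      simpa using hr.int_add_int_mul_eq_zero (u := u) (v := -v) (by push_cast; linarith)
    have hprod : (u + v * r) * -(u - v * r) = ((D * v ^ 2 - u ^ 2 : ℤ) : ℝ) := by
      push_cast; linear_combination (v : ℝ) ^ 2 * hrD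
    have hprod1 : (1 : ℝ) ≤ (u + v * r) * -(u - v * r) := by
      have hpos := mul_pos hspos (neg_pos.2 htneg)
      rw [hprod] at hpos ⊢
      exact_mod_cast hpos
    have hAB : A * B = ((x ^ 2 - D * y ^ 2 : ℤ) : ℝ) := by
      rw [hAdef, hBdef]; push_cast; linear_combination -(y : ℝ) ^ 2 * hrD
    have hDAB : (D : ℝ) < A * B := by rw [hAB]; exact_mod_cast hN
    have hamgm : 4 * ((A * B) * ((u + v * r) * -(u - v * r))) ≤ 4 * (D : ℝ) := by
      have hsum : A * -(u - v * r) + B * (u + v * r) = 2 * r := by linarith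
      calc 4 * ((A * B) * ((u + v * r) * -(u - v * r)))
          = (A * -(u - v * r) + B * (u + v * r)) ^ 2
            - (A * -(u - v * r) - B * (u + v * r)) ^ 2 := by ring
        _ ≤ (A * -(u - v * r) + B * (u + v * r)) ^ 2 := sub_le_self _ (sq_nonneg _)
        _ = 4 * (D : ℝ) := by rw [hsum, ← hrD]; ring
    nlinarith [le_mul_of_one_le_right (mul_pos hA hB).le hprod1]
  · have hx : x ≠ 0 ∨ y ≠ 0 := by
      by_contra! h
      simp [h] at hA
    have hg0 : 0 < Int.gcd x y := Int.gcd_pos_iff.2 hx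
    have hg1 : Int.gcd x y ≠ 1 := fun h ↦ hc (Int.isCoprime_iff_gcd_eq_one.2 h)
    have hg : (1 : ℝ) < Int.gcd x y := by exact_mod_cast (by omega : 1 < Int.gcd x y)
    obtain ⟨u, hu⟩ := Int.gcd_dvd_left x y
    obtain ⟨v, hv⟩ := Int.gcd_dvd_right x y
    have hxu : (x : ℝ) = Int.gcd x y * u := by exact_mod_cast hu
    have hyv : (y : ℝ) = Int.gcd x y * v := by exact_mod_cast hv
    have hAu : (x + y * r : ℝ) = Int.gcd x y * (u + v * r) := by
      linear_combination hxu + r * hyv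
    have hBu : (x - y * r : ℝ) = Int.gcd x y * (u - v * r) := by
      linear_combination hxu - r * hyv
    rw [hAu] at hA
    rw [hBu] at hB
    have hA' := pos_of_mul_pos_right hA (by positivity)
    have hB' := pos_of_mul_pos_right hB (by positivity)
    exact ⟨u, v, hA', hB', hAu ▸ lt_mul_of_one_lt_left hA' hg, hBu ▸ lt_mul_of_one_lt_left hB' hg⟩

theorem Squarefree.exists_int_eq_of_mul_sq_eq {D m : ℤ} (hsf : Squarefree D) {q : ℚ}
    (h : (D : ℚ) * q ^ 2 = m) : ∃ w : ℤ, q = w := by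
  have hmul : D * q.num ^ 2 = m * (q.den : ℤ) ^ 2 := by
    have : (D : ℚ) * q.num ^ 2 = m * q.den ^ 2 := by
      rw [← h, ← Rat.mul_den_eq_num]; ring
    exact_mod_cast this
  have hcop : IsCoprime ((q.den : ℤ) ^ 2) (q.num ^ 2) :=
    (Int.isCoprime_iff_gcd_eq_one (m := q.num).2 (by simpa [Int.gcd] using q.reduced)).symm.pow
  have hdvd : (q.den : ℤ) * q.den ∣ D := by
    rw [← sq]
    exact hcop.dvd_of_dvd_mul_right (hmul ▸ Dvd.intro_left m rfl)
  have hunit := Int.natAbs_of_isUnit (hsf _ hdvd)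
  exact ⟨q.num, (Rat.coe_int_num_of_den_eq_one (by simpa using hunit)).symm⟩

theorem Int.not_isSquare_of_emod_four {D : ℤ} (hD4 : D % 4 = 2 ∨ D % 4 = 3) : ¬ IsSquare D := by
  rintro ⟨c, rfl⟩
  rcases Int.even_or_odd' c with ⟨k, rfl | rfl⟩ <;> ring_nf at hD4 <;> omega

theorem Int.even_and_even_of_four_dvd_sq_sub_mul_sq {D m w : ℤ} (hD4 : D % 4 = 2 ∨ D % 4 = 3)
    (h : (4 : ℤ) ∣ m ^ 2 - D * w ^ 2) : Even m ∧ Even w := by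
  have hmod : (m ^ 2 - D * w ^ 2) % 4 = 0 := Int.emod_eq_zero_of_dvd h
  have hm4 : m % 4 = 0 ∨ m % 4 = 1 ∨ m % 4 = 2 ∨ m % 4 = 3 := by omega
  have hw4 : w % 4 = 0 ∨ w % 4 = 1 ∨ w % 4 = 2 ∨ w % 4 = 3 := by omega
  rw [Int.even_iff, Int.even_iff]
  rcases hD4 with hD | hD <;> rcases hm4 with h1 | h1 | h1 | h1 <;>
    rcases hw4 with h2 | h2 | h2 | h2 <;>
    simp [Int.sub_emod, Int.mul_emod, pow_two, hD, h1, h2] at hmod <;> omega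

section QuadraticField

variable {D : ℤ} {K : Type*} [Field K] {sd : K}

theorem RingHom.map_sqrt_eq_or_eq_neg {r : ℝ} (hrD : r ^ 2 = D) (hsd : sd ^ 2 = (D : K))
    (σ : K →+* ℝ) : σ sd = r ∨ σ sd = -r := by
  rw [← sq_eq_sq_iff_eq_or_eq_neg, ← map_pow, hsd, hrD, map_intCast]

theorem RingHom.map_int_add_int_mul_sqrt_pos {r : ℝ} (hrD : r ^ 2 = D) (hsd : sd ^ 2 = (D : K))
    {u v : ℤ} (h1 : (0 : ℝ) < u + v * r) (h2 : (0 : ℝ) < u - v * r) (σ : K →+* ℝ) :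
    0 < σ (u + v * sd) := by
  rw [map_add, map_mul, map_intCast, map_intCast]
  rcases σ.map_sqrt_eq_or_eq_neg hrD hsd with h | h <;> rw [h] <;> linarith

variable [NumberField K]

theorem linearIndependent_one_sqrt (hD : ¬ IsSquare D) (hsd : sd ^ 2 = (D : K)) :
    LinearIndependent ℚ ![(1 : K), sd] := by
  rw [LinearIndependent.pair_iff' one_ne_zero]
  rintro a rfl
  refine hD (Rat.isSquare_intCast_iff.1 ⟨a, ?_⟩)
  apply (algebraMap ℚ K).injective
  rw [Algebra.smul_def, mul_one] at hsd
  rw [map_intCast, ← hsd, map_mul, sq]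

theorem exists_basis_one_sqrt (hD : ¬ IsSquare D) (hsd : sd ^ 2 = (D : K))
    (hdeg : Module.finrank ℚ K = 2) :
    ∃ e : Module.Basis (Fin 2) ℚ K, ⇑e = ![1, sd] :=
  ⟨basisOfLinearIndependentOfCardEqFinrank (linearIndependent_one_sqrt hD hsd) (by simp [hdeg]),
    coe_basisOfLinearIndependentOfCardEqFinrank _ _⟩

theorem leftMulMatrix_of_basis_one_sqrt (hsd : sd ^ 2 = (D : K)) (e : Module.Basis (Fin 2) ℚ K)
    (he : ⇑e = ![1, sd]) (a b : ℚ) :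
    Algebra.leftMulMatrix e (a + b * sd) = !![a, D * b; b, a] := by
  have h0 : e 0 = 1 := by simp [he]
  have h1 : e 1 = sd := by simp [he]
  have hm0 : ((a : K) + b * sd) * e 0 = a • e 0 + b • e 1 := by
    simp [h0, h1, Algebra.smul_def]
  have hm1 : ((a : K) + b * sd) * e 1 = (D * b) • e 0 + a • e 1 := by
    simp only [h0, h1, Algebra.smul_def, map_mul, map_intCast, eq_ratCast]
    linear_combination (b : K) * hsd
  ext i j
  rw [Algebra.leftMulMatrix_eq_repr_mul]
  fin_cases j <;> simp only [Fin.zero_eta, Fin.mk_one, hm0, hm1] <;> fin_cases i <;>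
    simp

theorem norm_add_mul_sqrt (hD : ¬ IsSquare D) (hsd : sd ^ 2 = (D : K))
    (hdeg : Module.finrank ℚ K = 2) (a b : ℚ) :
    Algebra.norm ℚ ((a : K) + b * sd) = a ^ 2 - D * b ^ 2 := by
  obtain ⟨e, he⟩ := exists_basis_one_sqrt hD hsd hdeg
  rw [Algebra.norm_eq_matrix_det e, leftMulMatrix_of_basis_one_sqrt hsd e he,
    Matrix.det_fin_two_of]
  ring

theorem trace_add_mul_sqrt (hD : ¬ IsSquare D) (hsd : sd ^ 2 = (D : K))
    (hdeg : Module.finrank ℚ K = 2) (a b : ℚ) :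
    Algebra.trace ℚ K ((a : K) + b * sd) = 2 * a := by
  obtain ⟨e, he⟩ := exists_basis_one_sqrt hD hsd hdeg
  rw [Algebra.trace_eq_matrix_trace e, leftMulMatrix_of_basis_one_sqrt hsd e he,
    Matrix.trace_fin_two_of]
  ring

/-- The ring of integers of `ℚ(√D)` is contained in `ℤ[√D]` when `D ≡ 2, 3 (mod 4)`. -/
theorem NumberField.RingOfIntegers.exists_eq_int_add_int_mul_sqrt (hsf : Squarefree D)
    (hD4 : D % 4 = 2 ∨ D % 4 = 3) (hsd : sd ^ 2 = (D : K)) (hdeg : Module.finrank ℚ K = 2)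
    (α : 𝓞 K) : ∃ x y : ℤ, (α : K) = x + y * sd := by
  have hD := Int.not_isSquare_of_emod_four hD4
  obtain ⟨e, he⟩ := exists_basis_one_sqrt hD hsd hdeg
  obtain ⟨a, b, hab⟩ : ∃ a b : ℚ, (α : K) = a + b * sd := by
    refine ⟨e.repr α 0, e.repr α 1, ?_⟩
    have h := e.sum_repr (α : K)
    rw [Fin.sum_univ_two, he] at h
    simpa [Algebra.smul_def] using h.symm
  have hnorm := Algebra.coe_norm_int α
  have htrace := Algebra.coe_trace_int α
  rw [hab, norm_add_mul_sqrt hD hsd hdeg] at hnorm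
  rw [hab, trace_add_mul_sqrt hD hsd hdeg] at htrace
  set n := Algebra.norm ℤ α
  set m := Algebra.trace ℤ (𝓞 K) α
  obtain ⟨w, hw⟩ := hsf.exists_int_eq_of_mul_sq_eq (q := 2 * b) (m := m ^ 2 - 4 * n) (by
    push_cast; rw [hnorm, htrace]; ring)
  have h4 : m ^ 2 - D * w ^ 2 = 4 * n := by
    have : (m : ℚ) ^ 2 - D * w ^ 2 = 4 * n := by rw [hnorm, htrace, ← hw]; ring
    exact_mod_cast this
  obtain ⟨⟨x, hx⟩, ⟨y, hy⟩⟩ := Int.even_and_even_of_four_dvd_sq_sub_mul_sq hD4 ⟨n, h4⟩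
  have hax : a = x := by rw [hx] at htrace; push_cast at htrace; linarith
  have hby : b = y := by rw [hy] at hw; push_cast at hw; linarith
  exact ⟨x, y, by rw [hab, hax, hby]; simp⟩

end QuadraticField

/-- Let `D > 1` be squarefree with `D ≡ 2, 3 (mod 4)` and let `K = ℚ(√D)`
(a field of degree 2 over `ℚ` containing a square root `sd` of `D`, so that
`𝓞 K = ℤ[√D]`).  Then every indecomposable totally positive `α ∈ 𝓞 K`
satisfies `N(α) ≤ D`. -/
theorem norm_of_indecomposable_le_D
    (D : ℤ) (hD : 1 < D) (hsf : Squarefree D) (hD4 : D % 4 = 2 ∨ D % 4 = 3)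
    (K : Type) [Field K] [NumberField K]
    (sd : K) (hsd : sd ^ 2 = (D : K)) (hdeg : Module.finrank ℚ K = 2) :
    ∀ α : 𝓞 K, (∀ σ : K →+* ℝ, 0 < σ (α : K)) →
      (¬ ∃ β γ : 𝓞 K, (∀ σ : K →+* ℝ, 0 < σ (β : K)) ∧
        (∀ σ : K →+* ℝ, 0 < σ (γ : K)) ∧ α = β + γ) →
      Algebra.norm ℤ α ≤ D := by
  intro α hα hind
  by_contra! hN
  have hDsq := Int.not_isSquare_of_emod_four hD4
  set r : ℝ := √(D : ℝ)
  have hD0 : (0 : ℝ) < D := by exact_mod_cast zero_lt_one.trans hD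
  have hr0 : 0 < r := Real.sqrt_pos.2 hD0
  have hrD : r ^ 2 = D := Real.sq_sqrt hD0.le
  have hr : Irrational r := irrational_sqrt_intCast_iff.2 ⟨hDsq, by omega⟩
  -- The vacuous case of no real embedding is excluded by indecomposability.
  obtain ⟨σ⟩ : Nonempty (K →+* ℝ) := by
    by_contra h
    rw [not_nonempty_iff] at h
    exact hind ⟨α, 0, h.elim, h.elim, (add_zero α).symm⟩
  obtain ⟨x, y, hxy⟩ :=
    NumberField.RingOfIntegers.exists_eq_int_add_int_mul_sqrt hsf hD4 hsd hdeg α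
  have hnorm : Algebra.norm ℤ α = x ^ 2 - D * y ^ 2 := by
    have h := Algebra.coe_norm_int α
    have hxy' : (α : K) = ((x : ℚ) : K) + ((y : ℚ) : K) * sd := by simpa using hxy
    rw [hxy', norm_add_mul_sqrt hDsq hsd hdeg] at h
    exact_mod_cast h
  rw [hnorm] at hN
  have hAB : (0 : ℝ) < (x + y * r) * (x - y * r) := by
    have h : (x + y * r) * (x - y * r) = ((x ^ 2 - D * y ^ 2 : ℤ) : ℝ) := by
      push_cast; linear_combination -(y : ℝ) ^ 2 * hrD
    rw [h]
    exact_mod_cast (by omega : 0 < x ^ 2 - D * y ^ 2)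
  obtain ⟨hA, hB⟩ : (0 : ℝ) < x + y * r ∧ (0 : ℝ) < x - y * r := by
    refine (mul_pos_iff.1 hAB).resolve_right fun ⟨hA, hB⟩ ↦ ?_
    have h := hα σ
    rw [hxy, map_add, map_mul, map_intCast, map_intCast] at h
    rcases σ.map_sqrt_eq_or_eq_neg hrD hsd with hσ | hσ <;> rw [hσ] at h <;> linarith
  obtain ⟨u, v, h1, h2, h3, h4⟩ := exists_totallyPositive_decomposition hr hr0 hrD hA hB hN
  have hsd_int : IsIntegral ℤ sd :=
    IsIntegral.of_pow two_pos (hsd ▸ isIntegral_algebraMap (R := ℤ) (A := K) (x := D))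
  obtain ⟨s, hs⟩ : ∃ s : 𝓞 K, (s : K) = sd := ⟨⟨sd, hsd_int⟩, rfl⟩
  have hβ : (((u + v * s : 𝓞 K)) : K) = u + v * sd := by simp [hs]
  have hγ : ((α - (u + v * s) : 𝓞 K) : K) = ((x - u : ℤ) : K) + ((y - v : ℤ) : K) * sd := by
    rw [show ((α - (u + v * s) : 𝓞 K) : K) = α - (u + v * s : 𝓞 K) from map_sub _ _ _, hβ, hxy]
    push_cast
    ring
  refine hind ⟨u + v * s, α - (u + v * s), fun τ ↦ ?_, fun τ ↦ ?_, by ring⟩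
  · rw [hβ]
    exact τ.map_int_add_int_mul_sqrt_pos hrD hsd h1 h2
  · rw [hγ]
    exact τ.map_int_add_int_mul_sqrt_pos hrD hsd (by push_cast; linarith) (by push_cast; linarith)
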